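/- If one subsystem is decoupled, ρ_{A₁⋯Aₙ} = ρ_{A₁⋯A_{n−1}} ⊗ ρ_{Aₙ}, then Δ_P(A₁:⋯:A_{n−1}:Aₙ) = Δ_P(A₁:⋯:A_{n−1}). -/

import Mathlib

open scoped BigOperators ComplexOrder

noncomputable section

/-- Von Neumann entropy of a matrix: `−∑ λᵢ log λᵢ` over its eigenvalues
(defined to be `0` if the matrix is not Hermitian). -/
noncomputable def matEntropy {ι : Type} [Fintype ι] [DecidableEq ι]
    (ρ : Matrix ι ι ℂ) : ℝ :=
  if h : ρ.IsHermitian then ∑ i, Real.negMulLog (h.eigenvalues i) else 0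

/-- A density matrix: positive semidefinite with unit trace. -/
def IsDensityMatrix {ι : Type} [Fintype ι] (ρ : Matrix ι ι ℂ) : Prop :=
  ρ.PosSemidef ∧ ρ.trace = 1

instance sumElimFintype {κ π : Type} {α : κ → Type} {δ : π → Type}
    [∀ i, Fintype (α i)] [∀ k, Fintype (δ k)] :
    ∀ i : κ ⊕ π, Fintype (Sum.elim α δ i)
  | .inl a => inferInstanceAs (Fintype (α a))
  | .inr b => inferInstanceAs (Fintype (δ b))

instance sumElimDecEq {κ π : Type} {α : κ → Type} {δ : π → Type}
    [∀ i, DecidableEq (α i)] [∀ k, DecidableEq (δ k)] :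
    ∀ i : κ ⊕ π, DecidableEq (Sum.elim α δ i)
  | .inl a => inferInstanceAs (DecidableEq (α a))
  | .inr b => inferInstanceAs (DecidableEq (δ b))

/-- Reduced density matrix on the subsystems in `s` (partial trace over the rest). -/
noncomputable def reduce {κ : Type} [Fintype κ] [DecidableEq κ] {α : κ → Type}
    [∀ i, Fintype (α i)] (s : Finset κ)
    (ρ : Matrix (∀ i, α i) (∀ i, α i) ℂ) :
    Matrix (∀ i : {j // j ∈ s}, α i.1) (∀ i : {j // j ∈ s}, α i.1) ℂ :=
  Matrix.of fun f g => ∑ h : ∀ i : {j // j ∉ s}, α i.1,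
    ρ (fun i => if hi : i ∈ s then f ⟨i, hi⟩ else h ⟨i, hi⟩)
      (fun i => if hi : i ∈ s then g ⟨i, hi⟩ else h ⟨i, hi⟩)

/-- The (pure) density matrix `|ψ⟩⟨ψ|` of a state vector. -/
def vecState {ι : Type} (ψ : ι → ℂ) : Matrix ι ι ℂ :=
  Matrix.of fun x y => ψ x * star (ψ y)

/-- Multipartite mutual information `∑ᵢ S_{Aᵢ} − S_{A₁⋯Aₙ}`. -/
noncomputable def Imulti {κ : Type} [Fintype κ] [DecidableEq κ] {α : κ → Type}
    [∀ i, Fintype (α i)] [∀ i, DecidableEq (α i)]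
    (ρ : Matrix (∀ i, α i) (∀ i, α i) ℂ) : ℝ :=
  (∑ i, matEntropy (reduce {i} ρ)) - matEntropy ρ

/-- Merge an assignment on the original systems with one on the ancillas. -/
def mergeSum {κ π : Type} {α : κ → Type} {δ : π → Type}
    (f : ∀ i, α i) (h : ∀ k, δ k) : ∀ i : κ ⊕ π, Sum.elim α δ i
  | .inl a => f a
  | .inr b => h b

/-- The subsystems belonging to party `k` together with its ancilla. -/
def partyFinset {κ π : Type} [Fintype κ] [DecidableEq κ] [DecidableEq π]
    (p : κ → π) (k : π) : Finset (κ ⊕ π) :=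
  (Finset.univ.filter fun i => p i = k).image Sum.inl ∪ {Sum.inr k}

/-- `ψ` (on the original systems plus one ancilla `Fin (d k)` per party)
purifies `ρ`: tracing out all ancillas from `|ψ⟩⟨ψ|` gives back `ρ`. -/
def Purifies {κ π : Type} [Fintype κ] {α : κ → Type} [∀ i, Fintype (α i)]
    [Fintype π] [DecidableEq π] {d : π → ℕ}
    (ψ : (∀ i : κ ⊕ π, Sum.elim α (fun k => Fin (d k)) i) → ℂ)
    (ρ : Matrix (∀ i, α i) (∀ i, α i) ℂ) : Prop :=
  ∀ f g, (∑ h : ∀ k, Fin (d k), vecState ψ (mergeSum f h) (mergeSum g h)) = ρ f g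

/-- Multipartite entanglement of purification for the partition of the systems `κ`
into parties `π` given by `p`: the infimum over all purifications (with one ancilla
per party, of arbitrary finite dimension) of `∑ₖ S_{AₖAₖ'}`. -/
noncomputable def DeltaPart {κ π : Type} [Fintype κ] [DecidableEq κ]
    [Fintype π] [DecidableEq π] {α : κ → Type}
    [∀ i, Fintype (α i)] [∀ i, DecidableEq (α i)]
    (p : κ → π) (ρ : Matrix (∀ i, α i) (∀ i, α i) ℂ) : ℝ :=
  sInf { x | ∃ (d : π → ℕ) (ψ : (∀ i : κ ⊕ π, Sum.elim α (fun k => Fin (d k)) i) → ℂ),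
    Purifies ψ ρ ∧
    x = ∑ k : π, matEntropy (reduce (partyFinset p k) (vecState ψ)) }

/-- Bipartite-style entanglement of purification for the partition `p`:
the infimum over purifications of the entropy of the single party `k₀`
together with its ancilla. -/
noncomputable def EPart {κ π : Type} [Fintype κ] [DecidableEq κ]
    [Fintype π] [DecidableEq π] {α : κ → Type}
    [∀ i, Fintype (α i)] [∀ i, DecidableEq (α i)]
    (p : κ → π) (k₀ : π) (ρ : Matrix (∀ i, α i) (∀ i, α i) ℂ) : ℝ :=
  sInf { x | ∃ (d : π → ℕ) (ψ : (∀ i : κ ⊕ π, Sum.elim α (fun k => Fin (d k)) i) → ℂ),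
    Purifies ψ ρ ∧
    x = matEntropy (reduce (partyFinset p k₀) (vecState ψ)) }

open scoped Kronecker

lemma matEntropy_eq_sum_roots {ι : Type} [Fintype ι] [DecidableEq ι] {M : Matrix ι ι ℂ}
    (h : M.IsHermitian) :
    matEntropy M = (M.charpoly.roots.map fun z => Real.negMulLog z.re).sum := by
  rw [matEntropy, dif_pos h, h.roots_charpoly_eq_eigenvalues, Multiset.map_map]
  rfl

/-- Entropy is invariant under relabelling of the basis. -/
lemma matEntropy_submatrix_equiv {ι ι' : Type} [Fintype ι] [DecidableEq ι]
    [Fintype ι'] [DecidableEq ι'] (e : ι' ≃ ι) (M : Matrix ι ι ℂ) :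
    matEntropy (M.submatrix e e) = matEntropy M := by
  by_cases h : M.IsHermitian
  · rw [matEntropy_eq_sum_roots h, matEntropy_eq_sum_roots (h.submatrix e)]
    have := Matrix.charpoly_reindex e.symm M
    rw [Matrix.reindex_apply, Equiv.symm_symm] at this
    rw [this]
  · have h' : ¬ (M.submatrix e e).IsHermitian := fun h' => h <| by
      simpa using h'.submatrix e.symm
    simp [matEntropy, h, h']

lemma IsDensityMatrix.sum_eigenvalues {ι : Type} [Fintype ι] [DecidableEq ι]
    {M : Matrix ι ι ℂ} (h : IsDensityMatrix M) : ∑ i, h.1.1.eigenvalues i = 1 := by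
  have := h.1.1.trace_eq_sum_eigenvalues
  have h2 := congrArg Complex.re (this.symm.trans h.2)
  simpa using h2

lemma IsDensityMatrix.matEntropy_nonneg {ι : Type} [Fintype ι] [DecidableEq ι]
    {M : Matrix ι ι ℂ} (h : IsDensityMatrix M) : 0 ≤ matEntropy M := by
  rw [matEntropy, dif_pos h.1.1]
  refine Finset.sum_nonneg fun i _ => Real.negMulLog_nonneg (h.1.eigenvalues_nonneg i) ?_
  rw [← h.sum_eigenvalues]
  exact Finset.single_le_sum (fun j _ => h.1.eigenvalues_nonneg j) (Finset.mem_univ i)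

/-- A pure state has zero entropy. -/
lemma matEntropy_eq_zero_of_idempotent {ι : Type} [Fintype ι] [DecidableEq ι]
    {M : Matrix ι ι ℂ} (h : M * M = M) : matEntropy M = 0 := by
  rw [matEntropy]
  split_ifs with hM
  · refine Finset.sum_eq_zero fun i _ => ?_
    have h1 := hM.mulVec_eigenvectorBasis i
    have h2 : M.mulVec (M.mulVec (hM.eigenvectorBasis i).ofLp)
        = M.mulVec (hM.eigenvectorBasis i).ofLp := by
      rw [Matrix.mulVec_mulVec, h]
    rw [h1, Matrix.mulVec_smul, h1, smul_smul] at h2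
    have hne : (hM.eigenvectorBasis i).ofLp ≠ 0 := by
      intro h0
      exact hM.eigenvectorBasis.orthonormal.ne_zero i (by ext j; simp [h0])
    have h3 := smul_left_injective ℝ hne h2
    rcases (IsIdempotentElem.iff_eq_zero_or_one.mp h3) with h4 | h4 <;> simp [h4]
  · rfl

/-- Measuring in an orthonormal basis does not decrease entropy. -/
lemma matEntropy_le_sum_diag {ι : Type} [Fintype ι] [DecidableEq ι]
    {M : Matrix ι ι ℂ} (h : M.PosSemidef) {U : Matrix ι ι ℂ}
    (hU : U ∈ Matrix.unitaryGroup ι ℂ) :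
    matEntropy M ≤ ∑ i, Real.negMulLog ((star U * M * U) i i).re := by
  set V := h.1.eigenvectorUnitary
  set W : Matrix.unitaryGroup ι ℂ := star V * ⟨U, hU⟩ with hW
  have hspec := h.1.spectral_theorem
  rw [Unitary.conjStarAlgAut_apply] at hspec
  have hdiag : ∀ i, ((star U * M * U) i i).re
      = ∑ k, ‖(W : Matrix ι ι ℂ) k i‖ ^ 2 * h.1.eigenvalues k := by
    intro i
    have : star U * M * U = star (W : Matrix ι ι ℂ)
        * Matrix.diagonal (RCLike.ofReal ∘ h.1.eigenvalues) * (W : Matrix ι ι ℂ) := by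
      conv_lhs => rw [hspec]
      have hWc : (W : Matrix ι ι ℂ) = star (V : Matrix ι ι ℂ) * U := rfl
      rw [hWc, star_mul, star_star]
      simp only [V, mul_assoc]
    rw [this, Matrix.mul_apply, Complex.re_sum]
    refine Finset.sum_congr rfl fun k _ => ?_
    rw [Matrix.mul_diagonal, Matrix.star_apply, mul_right_comm, ← starRingEnd_apply,
      Complex.conj_mul']
    simp [← Complex.ofReal_pow]
  have hcol : ∀ i, ∑ k, ‖(W : Matrix ι ι ℂ) k i‖ ^ 2 = 1 := by
    intro i
    have := congrFun (congrFun (Matrix.mem_unitaryGroup_iff'.mp W.2) i) i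
    simp only [Matrix.mul_apply, Matrix.star_apply, ← starRingEnd_apply,
      Complex.conj_mul', Matrix.one_apply_eq] at this
    exact_mod_cast this
  have hrow : ∀ k, ∑ i, ‖(W : Matrix ι ι ℂ) k i‖ ^ 2 = 1 := by
    intro k
    have := congrFun (congrFun (Matrix.mem_unitaryGroup_iff.mp W.2) k) k
    simp only [Matrix.mul_apply, Matrix.star_apply, ← starRingEnd_apply,
      Complex.mul_conj', Matrix.one_apply_eq] at this
    exact_mod_cast this
  rw [matEntropy, dif_pos h.1]
  calc ∑ k, Real.negMulLog (h.1.eigenvalues k)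
      = ∑ k, ∑ i, ‖(W : Matrix ι ι ℂ) k i‖ ^ 2 * Real.negMulLog (h.1.eigenvalues k) := by
        refine Finset.sum_congr rfl fun k _ => ?_
        rw [← Finset.sum_mul, hrow, one_mul]
    _ = ∑ i, ∑ k, ‖(W : Matrix ι ι ℂ) k i‖ ^ 2 * Real.negMulLog (h.1.eigenvalues k) :=
        Finset.sum_comm
    _ ≤ _ := by
        refine Finset.sum_le_sum fun i _ => ?_
        rw [hdiag]
        have := Real.concaveOn_negMulLog.le_map_sum (t := Finset.univ)
          (w := fun k => ‖(W : Matrix ι ι ℂ) k i‖ ^ 2) (p := h.1.eigenvalues)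
          (fun _ _ => by positivity) (hcol i) (fun k _ => h.eigenvalues_nonneg k)
        simpa using this

/-- Subadditivity of the Shannon entropy. -/
lemma sum_negMulLog_le_marginals {a b : Type} [Fintype a] [Fintype b] {p : a × b → ℝ}
    (hp : ∀ x, 0 ≤ p x) (hsum : ∑ x, p x = 1) :
    ∑ x, Real.negMulLog (p x) ≤ ∑ i, Real.negMulLog (∑ j, p (i, j))
      + ∑ j, Real.negMulLog (∑ i, p (i, j)) := by
  set r := fun i => ∑ j, p (i, j) with hr
  set s := fun j => ∑ i, p (i, j) with hs
  have hr1 : ∑ i, r i = 1 := by rw [← hsum, Fintype.sum_prod_type]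
  have hs1 : ∑ j, s j = 1 := by rw [← hsum, Fintype.sum_prod_type_right]
  have key : ∀ x : a × b, Real.negMulLog (p x)
      ≤ -(p x * Real.log (r x.1)) - p x * Real.log (s x.2) + (r x.1 * s x.2 - p x) := by
    rintro ⟨i, j⟩
    have hri : p (i, j) ≤ r i := Finset.single_le_sum (f := fun j => p (i, j))
      (fun _ _ => hp _) (Finset.mem_univ j)
    have hsj : p (i, j) ≤ s j := Finset.single_le_sum (f := fun i => p (i, j))
      (fun _ _ => hp _) (Finset.mem_univ i)
    rcases (hp (i, j)).eq_or_lt with h0 | h0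
    · have := mul_nonneg ((hp _).trans hri) ((hp _).trans hsj)
      simpa [← h0] using this
    · have hr0 := h0.trans_le hri
      have hs0 := h0.trans_le hsj
      have := Real.log_le_sub_one_of_pos (div_pos (mul_pos hr0 hs0) h0)
      rw [Real.log_div (by positivity) h0.ne', Real.log_mul hr0.ne' hs0.ne'] at this
      have h2 := mul_le_mul_of_nonneg_left this h0.le
      have h3 : p (i, j) * (r i * s j / p (i, j) - 1) = r i * s j - p (i, j) := by
        field_simp
      rw [h3] at h2
      simp only [Real.negMulLog]
      linarith
  refine (Finset.sum_le_sum fun x _ => key x).trans_eq ?_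
  have e1 : ∑ x : a × b, p x * Real.log (r x.1) = ∑ i, r i * Real.log (r i) := by
    rw [Fintype.sum_prod_type]
    exact Finset.sum_congr rfl fun i _ =>
      (Finset.sum_mul _ (fun j => p (i, j)) (Real.log (r i))).symm
  have e2 : ∑ x : a × b, p x * Real.log (s x.2) = ∑ j, s j * Real.log (s j) := by
    rw [Fintype.sum_prod_type_right]
    exact Finset.sum_congr rfl fun j _ =>
      (Finset.sum_mul _ (fun i => p (i, j)) (Real.log (s j))).symm
  have e3 : ∑ x : a × b, r x.1 * s x.2 = 1 := by
    rw [Fintype.sum_prod_type, ← Finset.sum_mul_sum, hr1, hs1, one_mul]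
  simp only [Finset.sum_add_distrib, Finset.sum_sub_distrib, Finset.sum_neg_distrib, e1, e2, e3,
    hsum, Real.negMulLog, neg_mul]
  ring

/-- Conjugating by a product unitary and summing over the second factor of the diagonal is
conjugating the partial trace. -/
lemma sum_diag_kronecker_conj_left {a b : Type} [Fintype a] [DecidableEq a] [Fintype b]
    [DecidableEq b] (M : Matrix (a × b) (a × b) ℂ) (U : Matrix a a ℂ) {V : Matrix b b ℂ}
    (hV : V ∈ Matrix.unitaryGroup b ℂ) (i : a) :
    ∑ j, (star (U ⊗ₖ V) * M * U ⊗ₖ V) (i, j) (i, j)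
      = (star U * (Matrix.of fun x y => ∑ z, M (x, z) (y, z)) * U) i i := by
  have hV' : ∀ z w, ∑ j, star (V z j) * V w j = if w = z then 1 else 0 := by
    intro z w
    have := congrFun (congrFun (Matrix.mem_unitaryGroup_iff.mp hV) w) z
    simp only [Matrix.mul_apply, Matrix.star_apply, Matrix.one_apply] at this
    rw [← this]
    exact Finset.sum_congr rfl fun _ _ => mul_comm _ _
  simp only [Matrix.mul_apply, Matrix.star_apply, Matrix.kroneckerMap_apply,
    Matrix.of_apply, Fintype.sum_prod_type, Finset.sum_mul, Finset.mul_sum, star_mul']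
  calc _ = ∑ y, ∑ w, ∑ x, ∑ z, star (U x i) * M (x, z) (y, w) * U y i
        * ∑ j, star (V z j) * V w j := by
        rw [Finset.sum_comm]
        refine Finset.sum_congr rfl fun y _ => ?_
        rw [Finset.sum_comm]
        refine Finset.sum_congr rfl fun w _ => ?_
        rw [Finset.sum_comm]
        refine Finset.sum_congr rfl fun x _ => ?_
        rw [Finset.sum_comm]
        refine Finset.sum_congr rfl fun z _ => ?_
        rw [Finset.mul_sum]
        exact Finset.sum_congr rfl fun j _ => by ring
    _ = _ := by
        refine Finset.sum_congr rfl fun y _ => ?_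
        rw [Finset.sum_comm]
        refine Finset.sum_congr rfl fun x _ => ?_
        simp only [hV', mul_ite, mul_one, mul_zero, Finset.sum_ite_eq, Finset.mem_univ, if_true]

lemma sum_diag_kronecker_conj_right {a b : Type} [Fintype a] [DecidableEq a] [Fintype b]
    [DecidableEq b] (M : Matrix (a × b) (a × b) ℂ) {U : Matrix a a ℂ} (V : Matrix b b ℂ)
    (hU : U ∈ Matrix.unitaryGroup a ℂ) (j : b) :
    ∑ i, (star (U ⊗ₖ V) * M * U ⊗ₖ V) (i, j) (i, j)
      = (star V * (Matrix.of fun x y => ∑ z, M (z, x) (z, y)) * V) j j := by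
  refine Eq.trans ?_ (sum_diag_kronecker_conj_left (M.submatrix Prod.swap Prod.swap) V hU j)
  refine Finset.sum_congr rfl fun i _ => ?_
  simp only [Matrix.mul_apply, Matrix.star_apply, Matrix.kroneckerMap_apply,
    Matrix.submatrix_apply, Finset.sum_mul]
  refine Fintype.sum_equiv (Equiv.prodComm a b) _ _ fun x => ?_
  refine Fintype.sum_equiv (Equiv.prodComm a b) _ _ fun y => ?_
  simp [mul_comm]

lemma Matrix.IsHermitian.re_diag_eigenvectorUnitary {ι : Type} [Fintype ι] [DecidableEq ι]
    {M : Matrix ι ι ℂ} (h : M.IsHermitian) (i : ι) :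
    ((star (h.eigenvectorUnitary : Matrix ι ι ℂ) * M * h.eigenvectorUnitary) i i).re
      = h.eigenvalues i := by
  have := h.conjStarAlgAut_star_eigenvectorUnitary
  rw [Unitary.conjStarAlgAut_apply] at this
  simp only [Unitary.coe_star, star_star] at this
  rw [this]
  simp

/-- Subadditivity of the von Neumann entropy. -/
lemma matEntropy_le_add_marginals {a b : Type} [Fintype a] [DecidableEq a] [Fintype b]
    [DecidableEq b] {M : Matrix (a × b) (a × b) ℂ} (hM : IsDensityMatrix M)
    (hA : (Matrix.of fun x y => ∑ z, M (x, z) (y, z)).IsHermitian)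
    (hB : (Matrix.of fun x y => ∑ z, M (z, x) (z, y)).IsHermitian) :
    matEntropy M ≤ matEntropy (Matrix.of fun x y => ∑ z, M (x, z) (y, z))
      + matEntropy (Matrix.of fun x y => ∑ z, M (z, x) (z, y)) := by
  set U := hA.eigenvectorUnitary
  set V := hB.eigenvectorUnitary
  have hUV := Matrix.kronecker_mem_unitary U.2 V.2
  refine (matEntropy_le_sum_diag hM.1 hUV).trans ?_
  have hpos := hM.1.conjTranspose_mul_mul_same (U.1 ⊗ₖ V.1)
  have hp := sum_negMulLog_le_marginals (a := a) (b := b)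
    (p := fun x => ((star (U.1 ⊗ₖ V.1) * M * U.1 ⊗ₖ V.1) x x).re)
    (fun x => (Complex.le_def.mp (hpos.diag_nonneg (i := x))).1) (by
      have h1 : (star (U.1 ⊗ₖ V.1) * M * U.1 ⊗ₖ V.1).trace = 1 := by
        rw [Matrix.trace_mul_cycle, ← hM.2]
        congr 1
        rw [Matrix.mem_unitaryGroup_iff.mp hUV, one_mul]
      have h2 := congrArg Complex.re h1
      simpa [Matrix.trace] using h2)
  refine hp.trans_eq ?_
  rw [matEntropy, dif_pos hA, matEntropy, dif_pos hB]
  congr 1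
  · refine Finset.sum_congr rfl fun i _ => ?_
    rw [← Complex.re_sum, sum_diag_kronecker_conj_left M _ V.2,
      hA.re_diag_eigenvectorUnitary]
  · refine Finset.sum_congr rfl fun i _ => ?_
    rw [← Complex.re_sum, sum_diag_kronecker_conj_right M _ U.2,
      hB.re_diag_eigenvectorUnitary]

/-- Conditionals on equivalent propositions agree, whatever the decidability instances. -/
lemma ite_eq_of_iff {p q : Prop} (dp : Decidable p) (dq : Decidable q) (h : p ↔ q)
    {A : Type} (x y : A) : @ite A p dp x y = @ite A q dq x y := by
  split_ifs <;> tauto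

open Classical in
/-- The reduced state of `|ψ⟩⟨ψ|` on a subsystem, described by its coordinate `pr` and the relation
`R` of having the same coordinates on the complementary subsystem. -/
def partyMat {X a : Type} [Fintype X] (pr : X → a) (R : X → X → Prop) (ψ : X → ℂ) :
    Matrix a a ℂ :=
  Matrix.of fun x y => ∑ z, ∑ w,
    if pr z = x ∧ pr w = y ∧ R z w then ψ z * star (ψ w) else 0

lemma partyMat_comp_equiv {X X' a a' : Type} [Fintype X] [Fintype X']
    {pr : X → a} {R : X → X → Prop} {pr' : X' → a'} {R' : X' → X' → Prop} (ψ : X' → ℂ)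
    (g : X ≃ X') (e : a ≃ a') (hpr : ∀ z, pr' (g z) = e (pr z))
    (hR : ∀ z w, R' (g z) (g w) ↔ R z w) :
    (partyMat pr' R' ψ).submatrix e e = partyMat pr R (ψ ∘ g) := by
  ext x y
  simp only [partyMat, Matrix.submatrix_apply, Matrix.of_apply, Function.comp]
  symm
  refine Fintype.sum_equiv g _ _ fun z => Fintype.sum_equiv g _ _ fun w => ?_
  refine ite_eq_of_iff _ _ ?_ _ _
  rw [hpr, hpr, hR, e.apply_eq_iff_eq, e.apply_eq_iff_eq]

lemma matEntropy_partyMat_comp_equiv {X X' a a' : Type} [Fintype X] [Fintype X']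
    [Fintype a] [DecidableEq a] [Fintype a'] [DecidableEq a']
    {pr : X → a} {R : X → X → Prop} {pr' : X' → a'} {R' : X' → X' → Prop} {ψ : X' → ℂ}
    {φ : X → ℂ} (g : X ≃ X') (hφ : ∀ z, φ z = ψ (g z)) (e : a ≃ a')
    (hpr : ∀ z, pr' (g z) = e (pr z)) (hR : ∀ z w, R' (g z) (g w) ↔ R z w) :
    matEntropy (partyMat pr' R' ψ) = matEntropy (partyMat pr R φ) := by
  obtain rfl : φ = ψ ∘ g := funext hφ
  rw [← partyMat_comp_equiv ψ g e hpr hR, matEntropy_submatrix_equiv]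

lemma partyMat_posSemidef {X a : Type} [Fintype X] [Fintype a] (pr : X → a)
    {R : X → X → Prop} (hR : Equivalence R) (ψ : X → ℂ) : (partyMat pr R ψ).PosSemidef := by
  classical
  have hR' : ∀ z w, R z w ↔ R z = R w := fun z w =>
    ⟨fun h => funext fun u => propext ⟨fun hu => hR.trans (hR.symm h) hu, fun hu => hR.trans h hu⟩,
      fun h => h ▸ hR.refl w⟩
  have : partyMat pr R ψ = ∑ c : X → Prop, Matrix.vecMulVec
      (fun x => ∑ z, if pr z = x ∧ R z = c then ψ z else 0)
      (star fun x => ∑ z, if pr z = x ∧ R z = c then ψ z else 0) := by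
    ext x y
    simp only [partyMat, Matrix.of_apply, Matrix.sum_apply, Matrix.vecMulVec_apply, Pi.star_apply,
      star_sum, Finset.sum_mul_sum]
    rw [Finset.sum_comm]
    refine Eq.trans ?_ Finset.sum_comm
    rw [Finset.sum_comm]
    refine Finset.sum_congr rfl fun z _ => ?_
    refine Eq.trans ?_ Finset.sum_comm
    refine Finset.sum_congr rfl fun w _ => ?_
    rw [Finset.sum_eq_single (R z)]
    · simp only [hR']
      by_cases h1 : pr z = x <;> by_cases h2 : pr w = y <;> by_cases h3 : R z = R w <;>
        simp [h1, h2, h3, eq_comm]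
    · intro c _ hc
      simp [hc.symm]
    · simp
  rw [this]
  exact Matrix.posSemidef_sum _ fun c _ => Matrix.posSemidef_vecMulVec_self_star _

lemma trace_partyMat {X a : Type} [Fintype X] [Fintype a] {pr : X → a}
    {R : X → X → Prop} (hR : ∀ z, R z z) (hsep : ∀ z w, pr z = pr w → R z w → z = w)
    (ψ : X → ℂ) : (partyMat pr R ψ).trace = ∑ z, ψ z * star (ψ z) := by
  classical
  simp only [Matrix.trace, partyMat, Matrix.diag_apply, Matrix.of_apply]
  rw [Finset.sum_comm]
  refine Finset.sum_congr rfl fun z _ => ?_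
  rw [Finset.sum_comm, Finset.sum_eq_single z, Finset.sum_eq_single (pr z)]
  · simp [hR]
  · intro x _ hx
    simp [hx.symm]
  · simp
  · intro w _ hw
    refine Finset.sum_eq_zero fun x _ => if_neg ?_
    rintro ⟨rfl, h2, h3⟩
    exact hw (hsep z w h2.symm h3).symm
  · simp

/-- Subadditivity of entropy for two disjoint subsystems of a pure state. -/
lemma matEntropy_partyMat_prod_le {X a b : Type} [Fintype X] [Fintype a] [DecidableEq a]
    [Fintype b] [DecidableEq b] {pr₁ : X → a} {pr₂ : X → b} {R R₁ R₂ : X → X → Prop}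
    (hR : Equivalence R) (hsep : ∀ z w, pr₁ z = pr₁ w → pr₂ z = pr₂ w → R z w → z = w)
    (h₁ : ∀ z w, R₁ z w ↔ pr₂ z = pr₂ w ∧ R z w) (h₂ : ∀ z w, R₂ z w ↔ pr₁ z = pr₁ w ∧ R z w)
    {ψ : X → ℂ} (hψ : ∑ z, ψ z * star (ψ z) = 1) :
    matEntropy (partyMat (fun z => (pr₁ z, pr₂ z)) R ψ)
      ≤ matEntropy (partyMat pr₁ R₁ ψ) + matEntropy (partyMat pr₂ R₂ ψ) := by
  classical
  have hA : partyMat pr₁ R₁ ψ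
      = Matrix.of fun x y => ∑ c, partyMat (fun z => (pr₁ z, pr₂ z)) R ψ (x, c) (y, c) := by
    ext x y
    simp only [partyMat, Matrix.of_apply]
    refine Eq.trans ?_ Finset.sum_comm
    refine Finset.sum_congr rfl fun z _ => ?_
    refine Eq.trans ?_ Finset.sum_comm
    refine Finset.sum_congr rfl fun w _ => ?_
    rw [Finset.sum_eq_single (pr₂ z)]
    · refine ite_eq_of_iff _ _ ?_ _ _
      simp only [h₁, Prod.mk.injEq]
      grind
    · intro c _ hc
      simp [hc.symm]
    · simp
  have hB : partyMat pr₂ R₂ ψ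
      = Matrix.of fun x y => ∑ c, partyMat (fun z => (pr₁ z, pr₂ z)) R ψ (c, x) (c, y) := by
    ext x y
    simp only [partyMat, Matrix.of_apply]
    refine Eq.trans ?_ Finset.sum_comm
    refine Finset.sum_congr rfl fun z _ => ?_
    refine Eq.trans ?_ Finset.sum_comm
    refine Finset.sum_congr rfl fun w _ => ?_
    rw [Finset.sum_eq_single (pr₁ z)]
    · refine ite_eq_of_iff _ _ ?_ _ _
      simp only [h₂, Prod.mk.injEq]
      grind
    · intro c _ hc
      simp [hc.symm]
    · simp
  have hR₁ : Equivalence R₁ := by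
    refine ⟨fun z => (h₁ z z).2 ⟨rfl, hR.refl z⟩, fun {z w} h => ?_, fun {z w u} h h' => ?_⟩
    · exact (h₁ _ _).2 ⟨((h₁ _ _).1 h).1.symm, hR.symm ((h₁ _ _).1 h).2⟩
    · exact (h₁ _ _).2 ⟨((h₁ _ _).1 h).1.trans ((h₁ _ _).1 h').1,
        hR.trans ((h₁ _ _).1 h).2 ((h₁ _ _).1 h').2⟩
  have hR₂ : Equivalence R₂ := by
    refine ⟨fun z => (h₂ z z).2 ⟨rfl, hR.refl z⟩, fun {z w} h => ?_, fun {z w u} h h' => ?_⟩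
    · exact (h₂ _ _).2 ⟨((h₂ _ _).1 h).1.symm, hR.symm ((h₂ _ _).1 h).2⟩
    · exact (h₂ _ _).2 ⟨((h₂ _ _).1 h).1.trans ((h₂ _ _).1 h').1,
        hR.trans ((h₂ _ _).1 h).2 ((h₂ _ _).1 h').2⟩
  have hA' := (partyMat_posSemidef pr₁ hR₁ ψ).1
  have hB' := (partyMat_posSemidef pr₂ hR₂ ψ).1
  rw [hA] at hA' ⊢
  rw [hB] at hB' ⊢
  refine matEntropy_le_add_marginals ⟨partyMat_posSemidef _ hR ψ, ?_⟩ hA' hB'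
  rw [trace_partyMat hR.refl (fun z w h h' => ?_), hψ]
  exact hsep z w (Prod.mk.inj h).1 (Prod.mk.inj h).2 h'

/-- A tensor factor outside the party only contributes its squared norm. -/
lemma partyMat_tensor {Y Z a : Type} [Fintype Y] [Fintype Z] (pr : Z → a) (R : Z → Z → Prop)
    (φ : Y → ℂ) (ψ : Z → ℂ) :
    partyMat (fun z : Y × Z => pr z.2) (fun z w => z.1 = w.1 ∧ R z.2 w.2)
      (fun z => φ z.1 * ψ z.2) = (∑ y, φ y * star (φ y)) • partyMat pr R ψ := by
  classical
  ext x y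
  simp only [partyMat, Matrix.of_apply, Matrix.smul_apply, smul_eq_mul, Fintype.sum_prod_type,
    Finset.sum_mul]
  refine Finset.sum_congr rfl fun u _ => ?_
  rw [Finset.mul_sum]
  refine Finset.sum_congr rfl fun z _ => ?_
  rw [Finset.sum_eq_single u, Finset.mul_sum]
  · refine Finset.sum_congr rfl fun w _ => ?_
    simp only [true_and, mul_ite, mul_zero, star_mul']
    refine if_congr Iff.rfl ?_ rfl
    ring
  · intro v _ hv
    simp [hv.symm]
  · simp

lemma partyMat_id (X : Type) [Fintype X] (ψ : X → ℂ) :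
    partyMat (id : X → X) (fun _ _ => True) ψ = vecState ψ := by
  classical
  ext x y
  simp [partyMat, vecState, ite_and]

lemma matEntropy_vecState {X : Type} [Fintype X] [DecidableEq X] {ψ : X → ℂ}
    (hψ : ∑ z, ψ z * star (ψ z) = 1) : matEntropy (vecState ψ) = 0 := by
  apply matEntropy_eq_zero_of_idempotent
  ext x y
  simp only [vecState, Matrix.mul_apply, Matrix.of_apply]
  calc _ = ψ x * star (ψ y) * ∑ z, ψ z * star (ψ z) := by
        rw [Finset.mul_sum]
        exact Finset.sum_congr rfl fun z _ => by ring
    _ = _ := by rw [hψ, mul_one]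

lemma reduce_vecState {κ : Type} [Fintype κ] [DecidableEq κ] {α : κ → Type}
    [∀ i, Fintype (α i)] (s : Finset κ) (ψ : (∀ i, α i) → ℂ) :
    reduce s (vecState ψ) = partyMat (fun z (i : {j // j ∈ s}) => z i.1)
      (fun z w => ∀ i ∉ s, z i = w i) ψ := by
  classical
  ext f g
  simp only [reduce, partyMat, vecState, Matrix.of_apply]
  let e := Equiv.piEquivPiSubtypeProd (· ∈ s) α
  rw [← e.symm.sum_comp, Fintype.sum_prod_type, Finset.sum_eq_single f]
  · refine Finset.sum_congr rfl fun h _ => ?_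
    rw [← e.symm.sum_comp, Fintype.sum_prod_type, Finset.sum_eq_single g, Finset.sum_eq_single h]
    · rw [if_pos]
      · rfl
      · refine ⟨?_, ?_, ?_⟩
        · ext i; simp [e, Equiv.piEquivPiSubtypeProd]
        · ext i; simp [e, Equiv.piEquivPiSubtypeProd]
        · intro i hi; simp [e, Equiv.piEquivPiSubtypeProd, hi]
    · intro h' _ hh'
      refine if_neg fun hc => hh' ?_
      ext i
      have := hc.2.2 i.1 i.2
      simpa [e, Equiv.piEquivPiSubtypeProd, i.2] using this.symm
    · simp
    · intro g' _ hg'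
      refine Finset.sum_eq_zero fun h' _ => if_neg fun hc => hg' ?_
      ext i
      have := congrFun hc.2.1 i
      simpa [e, Equiv.piEquivPiSubtypeProd] using this
    · simp
  · intro f' _ hf'
    refine Finset.sum_eq_zero fun h' _ => Finset.sum_eq_zero fun w _ => if_neg fun hc => hf' ?_
    ext i
    have := congrFun hc.1 i
    simpa [e, Equiv.piEquivPiSubtypeProd] using this
  · simp

open scoped MatrixOrder Matrix.Norms.L2Operator in
lemma Matrix.PosSemidef.exists_eq_conjTranspose_mul_self {ι : Type} [Fintype ι]
    {M : Matrix ι ι ℂ} (h : M.PosSemidef) : ∃ B : Matrix ι ι ℂ, M = B.conjTranspose * B := by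
  classical
  exact CStarAlgebra.nonneg_iff_eq_star_mul_self.mp h.nonneg

section Purification

variable {κ : Type} {α δ : κ → Type}

/-- The system and ancilla coordinates of party `k`. -/
def partyCoord (k : κ) (z : (∀ k, α k) × ∀ k, δ k) : α k × δ k := (z.1 k, z.2 k)

/-- Agreement of two configurations away from party `k`. -/
def AgreeOff (k : κ) (z w : (∀ k, α k) × ∀ k, δ k) : Prop :=
  ∀ j ≠ k, partyCoord j z = partyCoord j w

lemma agreeOff_equivalence (k : κ) : Equivalence (AgreeOff (α := α) (δ := δ) k) :=
  ⟨fun _ _ _ => rfl, fun h j hj => (h j hj).symm, fun h h' j hj => (h j hj).trans (h' j hj)⟩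

lemma eq_of_partyCoord_eq {z w : (∀ k, α k) × ∀ k, δ k}
    (h : ∀ k, partyCoord k z = partyCoord k w) : z = w :=
  Prod.ext (funext fun k => congrArg Prod.fst (h k)) (funext fun k => congrArg Prod.snd (h k))

lemma AgreeOff.eq {k : κ} {z w : (∀ k, α k) × ∀ k, δ k} (h : AgreeOff k z w)
    (hk : partyCoord k z = partyCoord k w) : z = w :=
  eq_of_partyCoord_eq fun j => by
    by_cases hj : j = k
    · subst hj; exact hk
    · exact h j hj

variable [Fintype κ] [DecidableEq κ] [∀ k, Fintype (α k)] [∀ k, Fintype (δ k)]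

/-- `Ψ` is a purification of `ρ`, with arbitrary finite types as ancillas. -/
def IsPurification (Ψ : (∀ k, α k) × (∀ k, δ k) → ℂ)
    (ρ : Matrix (∀ k, α k) (∀ k, α k) ℂ) : Prop :=
  ∀ f g, ρ f g = ∑ h, Ψ (f, h) * star (Ψ (g, h))

lemma IsPurification.sum_norm {Ψ : (∀ k, α k) × (∀ k, δ k) → ℂ}
    {ρ : Matrix (∀ k, α k) (∀ k, α k) ℂ} (h : IsPurification Ψ ρ) (hρ : IsDensityMatrix ρ) :
    ∑ z, Ψ z * star (Ψ z) = 1 := by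
  rw [← hρ.2, Fintype.sum_prod_type]
  exact Finset.sum_congr rfl fun f _ => (h f f).symm

lemma IsPurification.isDensityMatrix_partyMat {Ψ : (∀ k, α k) × (∀ k, δ k) → ℂ}
    {ρ : Matrix (∀ k, α k) (∀ k, α k) ℂ} (h : IsPurification Ψ ρ) (hρ : IsDensityMatrix ρ)
    (k : κ) : IsDensityMatrix (partyMat (partyCoord k) (AgreeOff k) Ψ) := by
  refine ⟨partyMat_posSemidef _ (agreeOff_equivalence k) Ψ, ?_⟩
  rw [trace_partyMat (agreeOff_equivalence k).refl (fun z w hk h' => h'.eq hk), h.sum_norm hρ]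

lemma exists_isPurification {ρ : Matrix (∀ k, α k) (∀ k, α k) ℂ} (hρ : ρ.PosSemidef) :
    ∃ Ψ : (∀ k, α k) × (∀ k, α k) → ℂ, IsPurification Ψ ρ := by
  obtain ⟨B, rfl⟩ := hρ.exists_eq_conjTranspose_mul_self
  exact ⟨fun z => star (B z.2 z.1), fun f g => by simp [Matrix.mul_apply]⟩

variable [∀ k, DecidableEq (α k)] [∀ k, DecidableEq (δ k)]

/-- The sum over the parties of the entropy of system plus ancilla. -/
def partySum (Ψ : (∀ k, α k) × (∀ k, δ k) → ℂ) : ℝ :=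
  ∑ k, matEntropy (partyMat (partyCoord k) (AgreeOff k) Ψ)

lemma IsPurification.partySum_nonneg {Ψ : (∀ k, α k) × (∀ k, δ k) → ℂ}
    {ρ : Matrix (∀ k, α k) (∀ k, α k) ℂ} (h : IsPurification Ψ ρ) (hρ : IsDensityMatrix ρ) :
    0 ≤ partySum Ψ :=
  Finset.sum_nonneg fun k _ => (h.isDensityMatrix_partyMat hρ k).matEntropy_nonneg

/-- Combining system and ancilla configurations into one indexed by the disjoint union. -/
def mergeSumEquiv (α : κ → Type) (d : κ → ℕ) : ((∀ k, α k) × ∀ k, Fin (d k)) ≃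
    ∀ i : κ ⊕ κ, Sum.elim α (fun k => Fin (d k)) i where
  toFun z := mergeSum z.1 z.2
  invFun F := (fun k => F (.inl k), fun k => F (.inr k))
  left_inv _ := rfl
  right_inv F := by ext (i | i) <;> rfl

lemma mem_partyFinset_inl {k j : κ} : (Sum.inl j : κ ⊕ κ) ∈ partyFinset id k ↔ j = k := by
  simpa [partyFinset] using eq_comm

lemma mem_partyFinset_inr {k j : κ} : (Sum.inr j : κ ⊕ κ) ∈ partyFinset id k ↔ j = k := by
  simp [partyFinset]

lemma exists_partyFinset_equiv (α : κ → Type) (d : κ → ℕ) (k : κ) :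
    ∃ e : (∀ i : {j // j ∈ partyFinset id k}, Sum.elim α (fun k => Fin (d k)) i.1)
      ≃ α k × Fin (d k), ∀ F, e F = (F ⟨.inl k, mem_partyFinset_inl.2 rfl⟩,
        F ⟨.inr k, mem_partyFinset_inr.2 rfl⟩) := by
  refine ⟨Equiv.ofBijective (fun F => (F ⟨.inl k, mem_partyFinset_inl.2 rfl⟩,
        F ⟨.inr k, mem_partyFinset_inr.2 rfl⟩)) ⟨fun F G h => ?_, fun x => ?_⟩, fun F => rfl⟩
  · ext ⟨i | i, hi⟩
    · obtain rfl := mem_partyFinset_inl.1 hi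
      exact (Prod.mk.inj h).1
    · obtain rfl := mem_partyFinset_inr.1 hi
      exact (Prod.mk.inj h).2
  · let F : ∀ i : κ ⊕ κ, i ∈ partyFinset id k → Sum.elim α (fun k => Fin (d k)) i
      | .inl j, hi => cast (congrArg α (mem_partyFinset_inl.1 hi).symm) x.1
      | .inr j, hi => cast (congrArg (fun k => Fin (d k)) (mem_partyFinset_inr.1 hi).symm) x.2
    exact ⟨fun i => F i.1 i.2, rfl⟩

/-- The entropy sum does not depend on how the ancillas are labelled. -/
lemma sum_matEntropy_reduce_partyFinset {d : κ → ℕ} (e : ∀ k, δ k ≃ Fin (d k))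
    (ψ : (∀ i : κ ⊕ κ, Sum.elim α (fun k => Fin (d k)) i) → ℂ) :
    ∑ k, matEntropy (reduce (partyFinset id k) (vecState ψ))
      = partySum (α := α) (δ := δ) fun z => ψ (mergeSum z.1 fun k => e k (z.2 k)) := by
  refine Finset.sum_congr rfl fun k _ => ?_
  rw [reduce_vecState]
  obtain ⟨E, hE⟩ := exists_partyFinset_equiv α d k
  refine matEntropy_partyMat_comp_equiv
    (((Equiv.refl _).prodCongr (Equiv.piCongrRight e)).trans (mergeSumEquiv α d)) (fun z => rfl)
    (((Equiv.refl _).prodCongr (e k)).trans E.symm) (fun z => ?_) (fun z w => ?_)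
  · refine E.injective ((hE _).trans ?_)
    exact (E.apply_symm_apply _).symm
  · constructor
    · intro h j hj
      have h1 := h (.inl j) (fun hm => hj (mem_partyFinset_inl.1 hm))
      have h2 := h (.inr j) (fun hm => hj (mem_partyFinset_inr.1 hm))
      exact Prod.ext h1 ((e j).injective h2)
    · rintro h (j | j) hj
      · exact congrArg Prod.fst (h j fun hm => hj (mem_partyFinset_inl.2 hm))
      · exact congrArg (e j) (congrArg Prod.snd (h j fun hm => hj (mem_partyFinset_inr.2 hm)))

/-- The values over which `DeltaPart id ρ` is an infimum. -/
def purificationValues (ρ : Matrix (∀ k, α k) (∀ k, α k) ℂ) : Set ℝ :=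
  { x | ∃ (d : κ → ℕ) (ψ : (∀ i : κ ⊕ κ, Sum.elim α (fun k => Fin (d k)) i) → ℂ),
    Purifies ψ ρ ∧
    x = ∑ k : κ, matEntropy (reduce (partyFinset id k) (vecState ψ)) }

lemma IsPurification.partySum_mem {Ψ : (∀ k, α k) × (∀ k, δ k) → ℂ}
    {ρ : Matrix (∀ k, α k) (∀ k, α k) ℂ} (h : IsPurification Ψ ρ) :
    partySum Ψ ∈ purificationValues ρ := by
  let e := fun k => Fintype.equivFin (δ k)
  let G := ((Equiv.refl (∀ k, α k)).prodCongr (Equiv.piCongrRight e)).trans (mergeSumEquiv α _)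
  refine ⟨fun k => Fintype.card (δ k), Ψ ∘ G.symm, fun f g => ?_, ?_⟩
  · rw [h f g]
    refine ((Equiv.piCongrRight e).sum_comp _).symm.trans ?_
    refine Finset.sum_congr rfl fun u _ => ?_
    have hG : ∀ f, G.symm (mergeSum f (Equiv.piCongrRight e u)) = (f, u) := fun f => by
      rw [Equiv.symm_apply_eq]; rfl
    simp only [vecState, Matrix.of_apply, Function.comp, hG]
  · rw [sum_matEntropy_reduce_partyFinset e]
    congr 1
    ext z
    exact congrArg Ψ (G.symm_apply_apply z).symm

lemma mem_purificationValues {ρ : Matrix (∀ k, α k) (∀ k, α k) ℂ} {x : ℝ} :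
    x ∈ purificationValues ρ ↔ ∃ (d : κ → ℕ) (Ψ : (∀ k, α k) × (∀ k, Fin (d k)) → ℂ),
      IsPurification Ψ ρ ∧ x = partySum Ψ := by
  constructor
  · rintro ⟨d, ψ, hψ, rfl⟩
    exact ⟨d, fun z => ψ (mergeSum z.1 z.2), fun f g => (hψ f g).symm,
      sum_matEntropy_reduce_partyFinset (fun k => Equiv.refl _) ψ⟩
  · rintro ⟨d, Ψ, hΨ, rfl⟩
    exact hΨ.partySum_mem

end Purification

section Split

variable {κ : Type} [Fintype κ] [DecidableEq κ]

/-- Splitting off the coordinate `l` of a dependent function. -/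
def splitAt (l : κ) (β : κ → Type) :
    (∀ k, β k) ≃ β l × ∀ k : {j // j ∈ ({l} : Finset κ)ᶜ}, β k.1 where
  toFun z := (z l, fun k => z k.1)
  invFun p j := if h : j = l then cast (congrArg β h.symm) p.1 else p.2 ⟨j, by simpa using h⟩
  left_inv z := by
    ext j
    by_cases h : j = l
    · subst h; simp
    · simp [h]
  right_inv p := by
    refine Prod.ext (by simp) (funext fun k => ?_)
    have : k.1 ≠ l := fun h => Finset.mem_compl.1 k.2 (Finset.mem_singleton.2 h)
    simp [this]

lemma splitAt_symm_self {l : κ} {β : κ → Type} (p) : (splitAt l β).symm p l = p.1 :=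
  congrArg Prod.fst ((splitAt l β).apply_symm_apply p)

lemma splitAt_symm_compl {l : κ} {β : κ → Type} (p) (k : {j // j ∈ ({l} : Finset κ)ᶜ}) :
    (splitAt l β).symm p k.1 = p.2 k :=
  congrFun (congrArg Prod.snd ((splitAt l β).apply_symm_apply p)) k

lemma sum_eq_add_sum_compl_singleton (l : κ) (F : κ → ℝ) :
    ∑ k, F k = F l + ∑ k : {j // j ∈ ({l} : Finset κ)ᶜ}, F k.1 := by
  rw [Fintype.sum_eq_add_sum_compl l, Finset.sum_coe_sort _ F]

lemma ne_of_mem_compl_singleton {l : κ} (k : {j // j ∈ ({l} : Finset κ)ᶜ}) : k.1 ≠ l :=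
  fun h => Finset.mem_compl.1 k.2 (Finset.mem_singleton.2 h)

variable {α δ : κ → Type}

/-- Splitting off party `l` from a configuration. -/
def splitConf (l : κ) : ((∀ k, α k) × ∀ k, δ k) ≃ (α l × δ l) ×
    ((∀ k : {j // j ∈ ({l} : Finset κ)ᶜ}, α k.1) × ∀ k : {j // j ∈ ({l} : Finset κ)ᶜ}, δ k.1) :=
  ((splitAt l α).prodCongr (splitAt l δ)).trans (Equiv.prodProdProdComm _ _ _ _)

lemma agreeOff_self_iff {l : κ} {z w : (∀ k, α k) × ∀ k, δ k} :
    AgreeOff l z w ↔ (splitConf l z).2 = (splitConf l w).2 := by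
  constructor
  · exact fun h => eq_of_partyCoord_eq fun k => h k.1 (ne_of_mem_compl_singleton k)
  · intro h j hj
    exact congrArg (partyCoord (⟨j, by simpa using hj⟩ : {j // j ∈ ({l} : Finset κ)ᶜ})) h

lemma agreeOff_compl_iff {l : κ} {k : {j // j ∈ ({l} : Finset κ)ᶜ}}
    {z w : (∀ k, α k) × ∀ k, δ k} :
    AgreeOff k.1 z w ↔ (splitConf l z).1 = (splitConf l w).1
      ∧ AgreeOff k (splitConf l z).2 (splitConf l w).2 := by
  constructor
  · exact fun h => ⟨h l (ne_of_mem_compl_singleton k).symm,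
      fun j hj => h j.1 fun hjk => hj (Subtype.ext hjk)⟩
  · rintro ⟨h1, h2⟩ j hj
    by_cases hjl : j = l
    · subst hjl; exact h1
    · exact h2 ⟨j, by simpa using hjl⟩ fun h => hj (congrArg Subtype.val h)

variable [∀ k, Fintype (α k)]

lemma reduce_posSemidef (s : Finset κ) {ρ : Matrix (∀ k, α k) (∀ k, α k) ℂ} (hρ : ρ.PosSemidef) :
    (reduce s ρ).PosSemidef := by
  have : reduce s ρ = ∑ h : ∀ i : {j // j ∉ s}, α i.1,
      ρ.submatrix (fun f i => if hi : i ∈ s then f ⟨i, hi⟩ else h ⟨i, hi⟩)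
        (fun f i => if hi : i ∈ s then f ⟨i, hi⟩ else h ⟨i, hi⟩) := by
    ext f g
    simp [reduce, Matrix.sum_apply]
  rw [this]
  exact Matrix.posSemidef_sum _ fun h _ => hρ.submatrix _

lemma trace_reduce (s : Finset κ) (ρ : Matrix (∀ k, α k) (∀ k, α k) ℂ) :
    (reduce s ρ).trace = ρ.trace := by
  simp only [Matrix.trace, Matrix.diag_apply, reduce, Matrix.of_apply]
  rw [← (Equiv.piEquivPiSubtypeProd (· ∈ s) α).symm.sum_comp, Fintype.sum_prod_type]
  rfl

lemma IsDensityMatrix.reduce (s : Finset κ) {ρ : Matrix (∀ k, α k) (∀ k, α k) ℂ}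
    (hρ : IsDensityMatrix ρ) : IsDensityMatrix (reduce s ρ) :=
  ⟨reduce_posSemidef s hρ.1, (trace_reduce s ρ).trans hρ.2⟩

lemma reduce_compl_singleton_apply (l : κ) (ρ : Matrix (∀ k, α k) (∀ k, α k) ℂ) (f g) :
    reduce ({l} : Finset κ)ᶜ ρ f g
      = ∑ a, ρ ((splitAt l α).symm (a, f)) ((splitAt l α).symm (a, g)) := by
  let : Unique {j // j ∉ ({l} : Finset κ)ᶜ} :=
    ⟨⟨⟨l, by simp⟩⟩, fun j => Subtype.ext (by simpa using j.2)⟩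
  have key : ∀ (h : ∀ i : {j // j ∉ ({l} : Finset κ)ᶜ}, α i.1) (f),
      (fun i => if hi : i ∈ ({l} : Finset κ)ᶜ then f ⟨i, hi⟩ else h ⟨i, hi⟩)
        = (splitAt l α).symm (h default, f) := by
    intro h f
    rw [Equiv.eq_symm_apply]
    refine Prod.ext ?_ (funext fun k => ?_)
    · exact dif_neg (by simp)
    · exact dif_pos k.2
  simp only [reduce, Matrix.of_apply, key]
  exact (Equiv.piUnique fun i : {j // j ∉ ({l} : Finset κ)ᶜ} => α i.1).sum_comp
    fun a => ρ ((splitAt l α).symm (a, f)) ((splitAt l α).symm (a, g))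

variable [∀ k, DecidableEq (α k)]

/-- Purifying a decoupled subsystem separately. -/
lemma purificationValues_subset_of_decoupled {l : κ} {ρ : Matrix (∀ k, α k) (∀ k, α k) ℂ}
    {ρ' : Matrix (∀ k : {j // j ∈ ({l} : Finset κ)ᶜ}, α k.1)
      (∀ k : {j // j ∈ ({l} : Finset κ)ᶜ}, α k.1) ℂ}
    {σ : Matrix (α l) (α l) ℂ} (hρ' : IsDensityMatrix ρ') (hσ : IsDensityMatrix σ)
    (hprod : ∀ f g, ρ f g = ρ' (fun k => f k.1) (fun k => g k.1) * σ (f l) (g l)) :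
    purificationValues ρ' ⊆ purificationValues ρ := by
  intro x hx
  obtain ⟨d', Ψ', hΨ', rfl⟩ := mem_purificationValues.1 hx
  obtain ⟨m, φ, hφ⟩ : ∃ (m : ℕ) (φ : α l × Fin m → ℂ),
      ∀ a b, σ a b = ∑ u, φ (a, u) * star (φ (b, u)) := by
    obtain ⟨B, rfl⟩ := hσ.1.exists_eq_conjTranspose_mul_self
    refine ⟨_, fun z => star (B ((Fintype.equivFin (α l)).symm z.2) z.1), fun a b => ?_⟩
    rw [(Fintype.equivFin (α l)).symm.sum_comp (fun u => star (B u a) * star (star (B u b)))]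
    simp [Matrix.mul_apply]
  obtain ⟨d, hd⟩ := (splitAt l fun _ => ℕ).surjective (m, d')
  obtain rfl : d l = m := congrArg Prod.fst hd
  obtain rfl : (fun k => d k.1) = d' := congrArg Prod.snd hd
  let S := splitConf (α := α) (δ := fun k => Fin (d k)) l
  let Ψ : (∀ k, α k) × (∀ k, Fin (d k)) → ℂ := fun z => φ (S z).1 * Ψ' (S z).2
  have hΨ : IsPurification Ψ ρ := by
    intro f g
    rw [hprod, hφ, hΨ', mul_comm, Finset.sum_mul_sum, ← Fintype.sum_prod_type',
      ← (splitAt l fun k => Fin (d k)).sum_comp]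
    refine Finset.sum_congr rfl fun h _ => ?_
    simp only [Ψ, star_mul']
    exact mul_mul_mul_comm _ _ _ _
  have hφ1 : ∑ z, φ z * star (φ z) = 1 := by
    rw [← hσ.2, Fintype.sum_prod_type]
    exact Finset.sum_congr rfl fun a _ => (hφ a a).symm
  suffices partySum Ψ' = partySum Ψ from this ▸ hΨ.partySum_mem
  rw [partySum, partySum, sum_eq_add_sum_compl_singleton l]
  have hl : matEntropy (partyMat (partyCoord l) (AgreeOff l) Ψ) = 0 := by
    have h0 := partyMat_tensor (id : α l × Fin (d l) → _) (fun _ _ => True) Ψ' φ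
    rw [hΨ'.sum_norm hρ', one_smul, partyMat_id] at h0
    rw [← matEntropy_vecState hφ1, ← h0]
    have hS : ∀ z, Ψ' (S z).2 * φ (S z).1 = Ψ z := fun z => mul_comm _ _
    have hR : ∀ z w, ((S z).2 = (S w).2 ∧ True) ↔ AgreeOff l z w := fun z w => by
      rw [agreeOff_self_iff, and_true]
    exact (matEntropy_partyMat_comp_equiv (pr' := Prod.snd) (R' := fun z w => z.1 = w.1 ∧ True)
      (ψ := fun z => Ψ' z.1 * φ z.2) (S.trans (Equiv.prodComm _ _)) (fun z => (hS z).symm)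
      (Equiv.refl _) (fun z => rfl) hR).symm
  rw [hl, zero_add]
  refine Finset.sum_congr rfl fun k _ => ?_
  have h0 := partyMat_tensor (partyCoord k) (AgreeOff k) φ Ψ'
  rw [hφ1, one_smul] at h0
  rw [← h0]
  exact matEntropy_partyMat_comp_equiv S (fun z => rfl) (Equiv.refl _) (fun z => rfl)
    fun z w => agreeOff_compl_iff.symm

/-- Handing the ancilla of party `k₀` the whole of party `l`. -/
def absorbEquiv {l : κ} (k₀ : {j // j ∈ ({l} : Finset κ)ᶜ}) : ((∀ k, α k) × ∀ k, δ k) ≃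
    (∀ k : {j // j ∈ ({l} : Finset κ)ᶜ}, α k.1) ×
      ∀ k : {j // j ∈ ({l} : Finset κ)ᶜ}, δ k.1 × (PLift (k = k₀) → α l × δ l) where
  toFun z := (fun k => z.1 k.1, fun k => (z.2 k.1, fun _ => (z.1 l, z.2 l)))
  invFun w := ((splitAt l α).symm (((w.2 k₀).2 ⟨rfl⟩).1, w.1),
    (splitAt l δ).symm (((w.2 k₀).2 ⟨rfl⟩).2, fun k => (w.2 k).1))
  left_inv z := Prod.ext ((splitAt l α).symm_apply_apply z.1) ((splitAt l δ).symm_apply_apply z.2)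
  right_inv w := by
    simp only [splitAt_symm_compl, splitAt_symm_self]
    refine Prod.ext rfl (funext fun k => Prod.ext rfl (funext fun h => ?_))
    obtain ⟨rfl⟩ := h
    rfl

/-- Discarding a subsystem does not increase the entropy sum: its purification can be handed to
another party. -/
lemma exists_purificationValues_reduce_le {l : κ} (k₀ : {j // j ∈ ({l} : Finset κ)ᶜ})
    {ρ : Matrix (∀ k, α k) (∀ k, α k) ℂ} (hρ : IsDensityMatrix ρ) {x : ℝ}
    (hx : x ∈ purificationValues ρ) :
    ∃ y ∈ purificationValues (reduce ({l} : Finset κ)ᶜ ρ), y ≤ x := by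
  classical
  obtain ⟨d, Ψ, hΨ, rfl⟩ := mem_purificationValues.1 hx
  let G := absorbEquiv (α := α) (δ := fun k => Fin (d k)) k₀
  have hpur : IsPurification (Ψ ∘ G.symm) (reduce ({l} : Finset κ)ᶜ ρ) := by
    intro f g
    let H : (α l × ∀ k, Fin (d k)) ≃ ∀ k : {j // j ∈ ({l} : Finset κ)ᶜ},
        Fin (d k.1) × (PLift (k = k₀) → α l × Fin (d l)) :=
      { toFun := fun p k => (p.2 k.1, fun _ => (p.1, p.2 l))
        invFun := fun w => (((w k₀).2 ⟨rfl⟩).1,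
          (splitAt l _).symm (((w k₀).2 ⟨rfl⟩).2, fun k => (w k).1))
        left_inv := fun p => Prod.ext rfl ((splitAt l _).symm_apply_apply p.2)
        right_inv := fun w => by
          simp only [splitAt_symm_compl, splitAt_symm_self]
          refine funext fun k => Prod.ext rfl (funext fun h => ?_)
          obtain ⟨rfl⟩ := h
          rfl }
    have hG : ∀ f p, G.symm (f, H p) = ((splitAt l α).symm (p.1, f), p.2) := fun f p =>
      Prod.ext rfl ((splitAt l _).symm_apply_apply p.2)
    rw [reduce_compl_singleton_apply, ← H.sum_comp, Fintype.sum_prod_type]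
    refine Finset.sum_congr rfl fun a _ => ?_
    simp only [Function.comp, hG]
    exact hΨ _ _
  refine ⟨_, hpur.partySum_mem, ?_⟩
  rw [partySum, partySum, sum_eq_add_sum_compl_singleton l,
    Fintype.sum_eq_add_sum_compl k₀,
    Fintype.sum_eq_add_sum_compl k₀ (fun k : {j // j ∈ ({l} : Finset κ)ᶜ} => matEntropy
      (partyMat (partyCoord k.1) (AgreeOff k.1) Ψ)), ← add_assoc]
  refine add_le_add ?_ (Finset.sum_le_sum fun k hk => le_of_eq ?_)
  · let e : (α k₀.1 × Fin (d k₀.1)) × (α l × Fin (d l)) ≃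
        α k₀.1 × (Fin (d k₀.1) × (PLift (k₀ = k₀) → α l × Fin (d l))) :=
      { toFun := fun p => (p.1.1, p.1.2, fun _ => p.2)
        invFun := fun p => ((p.1, p.2.1), p.2.2 ⟨rfl⟩)
        left_inv := fun p => rfl
        right_inv := fun p => rfl }
    let R : ((∀ k, α k) × ∀ k, Fin (d k)) → ((∀ k, α k) × ∀ k, Fin (d k)) → Prop :=
      fun z w => ∀ j, j ≠ k₀.1 → j ≠ l → partyCoord j z = partyCoord j w
    have hne := ne_of_mem_compl_singleton k₀
    rw [matEntropy_partyMat_comp_equiv (pr := fun z => (partyCoord k₀.1 z, partyCoord l z))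
      (R := R) G (φ := Ψ) (fun z => by simp) e (fun z => rfl)]
    · refine (matEntropy_partyMat_prod_le (R₁ := AgreeOff k₀.1) (R₂ := AgreeOff l)
        ⟨fun _ _ _ _ => rfl, fun h j h1 h2 => (h j h1 h2).symm,
          fun h h' j h1 h2 => (h j h1 h2).trans (h' j h1 h2)⟩ ?_ ?_ ?_ (hΨ.sum_norm hρ)).trans_eq
          (add_comm _ _)
      · intro z w h1 h2 h
        refine eq_of_partyCoord_eq fun j => ?_
        by_cases hj : j = k₀.1
        · subst hj; exact h1
        · by_cases hj' : j = l
          · subst hj'; exact h2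
          · exact h j hj hj'
      · refine fun z w => ⟨fun h => ⟨h l hne.symm, fun j h1 _ => h j h1⟩, fun h j hj => ?_⟩
        by_cases hj' : j = l
        · subst hj'; exact h.1
        · exact h.2 j hj hj'
      · refine fun z w => ⟨fun h => ⟨h _ hne, fun j _ h2 => h j h2⟩, fun h j hj => ?_⟩
        by_cases hj' : j = k₀.1
        · subst hj'; exact h.1
        · exact h.2 j hj' hj
    · intro z w
      constructor
      · intro h j h1 h2
        have hj := h ⟨j, by simpa using h2⟩ fun h => h1 (congrArg Subtype.val h)
        have e1 : z.1 j = w.1 j := congrArg (fun p => p.1) hj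
        have e2 : z.2 j = w.2 j := congrArg (fun p => p.2.1) hj
        exact Prod.ext e1 e2
      · intro h j hj
        have h1 := h j.1 (fun h => hj (Subtype.ext h)) (ne_of_mem_compl_singleton j)
        have e1 : z.1 j.1 = w.1 j.1 := congrArg Prod.fst h1
        have e2 : z.2 j.1 = w.2 j.1 := congrArg Prod.snd h1
        exact Prod.ext e1 (Prod.ext e2 (funext fun h => absurd h.down hj))
  · have hk₀ : k ≠ k₀ := by simpa using hk
    let e : α k.1 × Fin (d k.1) ≃
        α k.1 × (Fin (d k.1) × (PLift (k = k₀) → α l × Fin (d l))) :=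
      { toFun := fun p => (p.1, p.2, fun h => absurd h.down hk₀)
        invFun := fun p => (p.1, p.2.1)
        left_inv := fun p => rfl
        right_inv := fun p => Prod.ext rfl (Prod.ext rfl (funext fun h => absurd h.down hk₀)) }
    refine matEntropy_partyMat_comp_equiv G (fun z => by simp) e
      (fun z => Prod.ext rfl (Prod.ext rfl (funext fun h => absurd h.down hk₀))) fun z w => ?_
    rw [agreeOff_compl_iff]
    constructor
    · intro h
      refine ⟨congrFun (congrArg (fun p => p.2.2) (h k₀ hk₀.symm)) ⟨rfl⟩, fun j hj => ?_⟩
      have e1 : z.1 j.1 = w.1 j.1 := congrArg (fun p => p.1) (h j hj)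
      have e2 : z.2 j.1 = w.2 j.1 := congrArg (fun p => p.2.1) (h j hj)
      exact Prod.ext e1 e2
    · rintro ⟨h1, h2⟩ j hj
      have e1 : z.1 j.1 = w.1 j.1 := congrArg Prod.fst (h2 j hj)
      have e2 : z.2 j.1 = w.2 j.1 := congrArg Prod.snd (h2 j hj)
      exact Prod.ext e1 (Prod.ext e2 (funext fun _ => h1))

lemma zero_mem_lowerBounds_purificationValues
    {ρ : Matrix (∀ k, α k) (∀ k, α k) ℂ} (hρ : IsDensityMatrix ρ) :
    0 ∈ lowerBounds (purificationValues ρ) := by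
  intro x hx
  obtain ⟨d, Ψ, hΨ, rfl⟩ := mem_purificationValues.1 hx
  exact hΨ.partySum_nonneg hρ

lemma purificationValues_nonempty {ρ : Matrix (∀ k, α k) (∀ k, α k) ℂ} (hρ : ρ.PosSemidef) :
    (purificationValues ρ).Nonempty := by
  obtain ⟨Ψ, hΨ⟩ := exists_isPurification hρ
  exact ⟨_, hΨ.partySum_mem⟩

/-- Decoupled subsystems do not contribute to the multipartite entanglement of purification. -/
lemma DeltaPart_id_of_decoupled (l : κ) {ρ : Matrix (∀ k, α k) (∀ k, α k) ℂ}
    (hρ : IsDensityMatrix ρ)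
    (hprod : ∀ f g, ρ f g
      = reduce (({l} : Finset κ)ᶜ) ρ (fun j => f j.1) (fun j => g j.1)
        * reduce ({l} : Finset κ) ρ (fun j => f j.1) (fun j => g j.1)) :
    DeltaPart id ρ = DeltaPart id (reduce (({l} : Finset κ)ᶜ) ρ) := by
  change sInf (purificationValues ρ) = sInf (purificationValues (reduce ({l} : Finset κ)ᶜ ρ))
  have hρ' := hρ.reduce ({l} : Finset κ)ᶜ
  let constAt : α l → ∀ j : {j // j ∈ ({l} : Finset κ)}, α j.1 := fun a j =>
    cast (congrArg α (Finset.mem_singleton.1 j.2).symm) a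
  have hconst : ∀ f : ∀ k, α k,
      constAt (f l) = fun j : {j // j ∈ ({l} : Finset κ)} => f j.1 := by
    intro f
    funext ⟨j, hj⟩
    obtain rfl := Finset.mem_singleton.1 hj
    rfl
  let e : α l ≃ ∀ j : {j // j ∈ ({l} : Finset κ)}, α j.1 :=
    { toFun := constAt
      invFun := fun f => f ⟨l, Finset.mem_singleton_self l⟩
      left_inv := fun a => rfl
      right_inv := fun f => by
        funext ⟨j, hj⟩
        obtain rfl := Finset.mem_singleton.1 hj
        rfl }
  have hσ : IsDensityMatrix ((reduce ({l} : Finset κ) ρ).submatrix e e) := by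
    refine ⟨(reduce_posSemidef _ hρ.1).submatrix e, ?_⟩
    rw [← hρ.2, ← trace_reduce ({l} : Finset κ) ρ]
    exact e.sum_comp fun f => reduce ({l} : Finset κ) ρ f f
  have hsub := purificationValues_subset_of_decoupled (ρ := ρ) hρ' hσ fun f g => by
    rw [hprod, Matrix.submatrix_apply]
    congr 2
    exacts [(hconst f).symm, (hconst g).symm]
  have hne := purificationValues_nonempty hρ'.1
  refine le_antisymm (csInf_le_csInf ⟨0, zero_mem_lowerBounds_purificationValues hρ⟩ hne hsub)
    (le_csInf (hne.mono hsub) fun x hx => ?_)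
  obtain ⟨y, hy, hyx⟩ : ∃ y ∈ purificationValues (reduce ({l} : Finset κ)ᶜ ρ), y ≤ x := by
    rcases isEmpty_or_nonempty {j // j ∈ ({l} : Finset κ)ᶜ} with h | ⟨⟨k₀⟩⟩
    · obtain ⟨y, hy⟩ := hne
      refine ⟨y, hy, ?_⟩
      obtain ⟨d, Ψ, -, rfl⟩ := mem_purificationValues.1 hy
      rw [partySum, Fintype.sum_empty]
      exact zero_mem_lowerBounds_purificationValues hρ hx
    · exact exists_purificationValues_reduce_le k₀ hρ hx
  exact (csInf_le ⟨0, zero_mem_lowerBounds_purificationValues hρ'⟩ hy).trans hyx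

end Split

/-- if the last subsystem is decoupled,
`ρ_{A₁⋯Aₙ} = ρ_{A₁⋯A_{n−1}} ⊗ ρ_{Aₙ}`, then
`Δ_P(A₁:⋯:A_{n−1}:Aₙ) = Δ_P(A₁:⋯:A_{n−1})`.
The subsystems are indexed by `Fin (n+1)`, the last one being `Fin.last n`. -/
theorem DeltaP_of_decoupled {n : ℕ} {α : Fin (n + 1) → Type}
    [∀ i, Fintype (α i)] [∀ i, DecidableEq (α i)]
    (ρ : Matrix (∀ i, α i) (∀ i, α i) ℂ) (hρ : IsDensityMatrix ρ)
    (hprod : ∀ f g, ρ f g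
      = reduce (({Fin.last n} : Finset (Fin (n + 1)))ᶜ) ρ (fun j => f j.1) (fun j => g j.1)
        * reduce ({Fin.last n} : Finset (Fin (n + 1))) ρ (fun j => f j.1) (fun j => g j.1)) :
    DeltaPart id ρ
      = DeltaPart id (reduce (({Fin.last n} : Finset (Fin (n + 1)))ᶜ) ρ) := by
  exact DeltaPart_id_of_decoupled (Fin.last n) hρ hprod
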